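/- Let R be a reduced local hypersurface of dimension 1 and let A, B be maximal Cohen-Macaulay R-modules. Then Tor_2^R(A, B) = 0 if and only if the tensor product A ⊗_R B is a maximal Cohen-Macaulay R-module. -/

import Mathlib

open CategoryTheory Opposite IsLocalRing TensorProduct

noncomputable abbrev ExtGroup (R : Type) [CommRing R] (i : ℕ)
    (M N : Type) [AddCommGroup M] [Module R M] [AddCommGroup N] [Module R N] : Type :=
  ((Ext R (ModuleCat R) i).obj (op (ModuleCat.of R M))).obj (ModuleCat.of R N)

noncomputable abbrev TorGroup (R : Type) [CommRing R] (i : ℕ)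
    (M N : Type) [AddCommGroup M] [Module R M] [AddCommGroup N] [Module R N] : Type :=
  ((Tor (ModuleCat R) i).obj (ModuleCat.of R M)).obj (ModuleCat.of R N)

/-- The depth of a module over a local ring, via vanishing of `Ext^i(k, M)`. -/
noncomputable def moduleDepth (R : Type) [CommRing R] [IsLocalRing R]
    (M : Type) [AddCommGroup M] [Module R M] : ℕ∞ :=
  sInf {i : ℕ∞ | ∃ n : ℕ, i = n ∧ Nontrivial (ExtGroup R n (ResidueField R) M)}

/-- A regular local ring of dimension `2`: a Noetherian local ring of Krull dimension `2`
whose maximal ideal is generated by two elements. -/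
def IsRegularLocalTwoDim (S : Type) [CommRing S] [IsLocalRing S] : Prop :=
  IsNoetherianRing S ∧ ringKrullDim S = 2 ∧
    ∃ x y : S, IsLocalRing.maximalIdeal S = Ideal.span {x, y}

/-- A maximal Cohen-Macaulay module over a one-dimensional local ring:
a finitely generated module of depth `1`. -/
def IsMCM1 (R : Type) [CommRing R] [IsLocalRing R]
    (M : Type) [AddCommGroup M] [Module R M] : Prop :=
  Module.Finite R M ∧ moduleDepth R M = 1


/-- In a local ring, a maximal ideal generated by one element that is not nilpotent forces a domain. -/
lemma aux_dvr (T : Type*) [CommRing T] [IsLocalRing T] [IsNoetherianRing T] (y : T)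
    (hy : maximalIdeal T = Ideal.span {y}) (hn : ¬ IsNilpotent y) : IsDomain T := by
  have key : ∀ a : T, a ≠ 0 → ∃ n u, IsUnit u ∧ a = u * y ^ n := by
    intro a ha
    have h1 : ∃ n, a ∉ (maximalIdeal T) ^ n := by
      by_contra! h
      apply ha
      have := Ideal.iInf_pow_eq_bot_of_isLocalRing (maximalIdeal T) (Ideal.IsPrime.ne_top')
      have h2 : a ∈ (⨅ i, maximalIdeal T ^ i) := by simpa [Ideal.mem_iInf] using h
      rw [this] at h2
      simpa using h2
    classical
    obtain ⟨n, hn1, hn2⟩ : ∃ n, a ∈ (maximalIdeal T) ^ n ∧ a ∉ (maximalIdeal T) ^ (n+1) := by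
      by_contra! h
      obtain ⟨n, hn⟩ := h1
      apply hn
      clear hn
      induction n with
      | zero => simp
      | succ k ih => exact h k ih
    rw [hy, Ideal.span_singleton_pow, Ideal.mem_span_singleton'] at hn1 hn2
    obtain ⟨u, hu⟩ := hn1
    refine ⟨n, u, ?_, hu.symm⟩
    by_contra hu'
    have : u ∈ maximalIdeal T := hu'
    rw [hy, Ideal.mem_span_singleton'] at this
    obtain ⟨v, rfl⟩ := this
    exact hn2 ⟨v, by rw [← hu]; ring⟩
  have : NoZeroDivisors T := by
    refine ⟨fun {a b} hab => ?_⟩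
    by_contra! h
    obtain ⟨n, u, hu, rfl⟩ := key a h.1
    obtain ⟨k, v, hv, rfl⟩ := key b h.2
    apply hn
    refine ⟨n + k, ?_⟩
    have h3 : (u * v) * y ^ (n + k) = 0 := by rw [← hab]; ring
    exact (hu.mul hv).mul_right_eq_zero.1 h3
  exact NoZeroDivisors.to_isDomain T

lemma aux_reg_seq (S : Type*) [CommRing S] [IsLocalRing S] [IsNoetherianRing S]
    (hdim : ringKrullDim S = 2) (x y : S) (hxy : maximalIdeal S = Ideal.span {x, y}) :
    IsDomain S ∧ ∃ x y : S, maximalIdeal S = Ideal.span {x, y} ∧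
      ∀ a b : S, x * a + y * b = 0 → ∃ c, a = y * c ∧ b = -(x * c) := by
  have hht : ∀ z : S, maximalIdeal S ∉ (Ideal.span {z}).minimalPrimes := by
    intro z hz
    have h1 := Ideal.height_le_one_of_isPrincipal_of_mem_minimalPrimes _ _ hz
    have h2 := IsLocalRing.maximalIdeal_height_eq_ringKrullDim (R := S)
    rw [hdim] at h2
    have h3 : (maximalIdeal S).height = 2 := WithBot.coe_injective h2
    rw [h3] at h1
    exact absurd h1 (by decide)
  -- no power of one generator lies in the ideal of the other
  have hpow : ∀ x y : S, maximalIdeal S = Ideal.span {x, y} → ∀ n, y ^ n ∉ Ideal.span {x} := by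
    intro x y hxy n hn
    apply hht x
    refine ⟨⟨inferInstance, ?_⟩, ?_⟩
    · rw [hxy]; exact Ideal.span_mono (by simp)
    · rintro p ⟨hp, hp'⟩ -
      rw [hxy, Ideal.span_le]
      have hyp : y ∈ p := hp.mem_of_pow_mem n (hp' hn)
      have hxp : x ∈ p := hp' (Ideal.mem_span_singleton_self x)
      rintro z (rfl | rfl) <;> assumption
  have hprime : ∀ x y : S, maximalIdeal S = Ideal.span {x, y} → (Ideal.span {x}).IsPrime := by
    intro x y hxy
    rw [← Ideal.Quotient.isDomain_iff_prime]
    have hxm : Ideal.span {x} ≤ maximalIdeal S := by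
      rw [hxy]; exact Ideal.span_mono (by simp)
    have : Nontrivial (S ⧸ Ideal.span {x}) :=
      Ideal.Quotient.nontrivial_iff.2 (fun h => Ideal.IsPrime.ne_top' (top_le_iff.1 (h ▸ hxm)))
    have : IsLocalRing (S ⧸ Ideal.span {x}) :=
      IsLocalRing.of_surjective' _ Ideal.Quotient.mk_surjective
    apply aux_dvr _ (Ideal.Quotient.mk _ y)
    · have h1 : maximalIdeal (S ⧸ Ideal.span {x}) = (maximalIdeal S).map (Ideal.Quotient.mk _) := by
        exact (IsLocalRing.map_maximalIdeal_of_surjective _ Ideal.Quotient.mk_surjective).symm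
      have hx0 : Ideal.Quotient.mk (Ideal.span {x}) x = 0 := by
        rw [Ideal.Quotient.eq_zero_iff_mem]; exact Ideal.mem_span_singleton_self x
      rw [h1, hxy, Ideal.map_span, Set.image_pair, hx0, Ideal.span_insert_zero]
    · rintro ⟨n, hn⟩
      rw [← map_pow, Ideal.Quotient.eq_zero_iff_mem] at hn
      exact hpow x y hxy n hn
  have hgen : ∀ n, maximalIdeal S = Ideal.span {x + y ^ (n+1), y} := by
    intro n
    rw [hxy]
    have := Ideal.span_pair_add_mul_left (x := y) (y := x) (y ^ n)
    rw [Ideal.span_pair_comm, ← this, Ideal.span_pair_comm, pow_succ]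
  obtain ⟨n, hn⟩ : ∃ n : ℕ, Ideal.span {x + y ^ (n+1)} ∉ minimalPrimes S := by
    by_contra! h
    have hfin := minimalPrimes.finite_of_isNoetherianRing S
    have : ¬ Function.Injective (fun n : ℕ => Ideal.span {x + y ^ (n+1)}) := fun hinj =>
      (Set.infinite_of_injective_forall_mem hinj h) hfin
    rw [Function.Injective] at this
    push Not at this
    obtain ⟨a, b, hab, hne⟩ := this
    wlog hlt : a < b generalizing a b
    · exact this b a hab.symm hne.symm (by omega)
    have h1 : x + y ^ (b+1) ∈ Ideal.span {x + y ^ (a+1)} := by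
      have hab' : Ideal.span {x + y ^ (a+1)} = Ideal.span {x + y ^ (b+1)} := hab
      rw [hab']; exact Ideal.mem_span_singleton_self _
    have h2 := Ideal.sub_mem _ (Ideal.mem_span_singleton_self (x + y ^ (a+1))) h1
    obtain ⟨c, rfl⟩ : ∃ c, b = a + c + 1 := ⟨b - a - 1, by omega⟩
    have h3 : x + y ^ (a+1) - (x + y ^ (a+c+1+1)) = y ^ (a+1) * (1 - y ^ (c+1)) := by ring
    rw [h3] at h2
    have hu : IsUnit (1 - y ^ (c+1)) := by
      have hy : y ^ (c+1) ∈ maximalIdeal S := Ideal.pow_mem_of_mem _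
        (by rw [hxy]; exact Ideal.subset_span (by simp)) _ (by omega)
      by_contra hu
      have h4 : (1 - y ^ (c+1)) ∈ maximalIdeal S := hu
      have h5 := Ideal.add_mem _ h4 hy
      rw [sub_add_cancel] at h5
      exact Ideal.IsPrime.ne_top' ((Ideal.eq_top_iff_one _).2 h5)
    rw [Ideal.mul_unit_mem_iff_mem _ hu] at h2
    exact hpow _ _ (hgen a) _ h2
  have hgn := hgen n
  generalize x + y ^ (n+1) = z at hn hgn
  have hzp := hprime z y (hgn)
  have hdom : IsDomain S := by
    obtain ⟨q, hq, hqz⟩ := Ideal.exists_minimalPrimes_le (J := Ideal.span {z}) (I := ⊥) bot_le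
    have hqp := hq.1.1
    have hzq : z ∉ q := by
      intro h
      apply hn
      have : Ideal.span {z} = q := le_antisymm ((Ideal.span_singleton_le_iff_mem _).2 h) hqz
      rw [this]; exact hq
    have hzm : Ideal.span {z} ≤ maximalIdeal S := by
      rw [hgn]; exact Ideal.span_mono (by simp)
    have : q = ⊥ := by
      apply Submodule.eq_bot_of_le_smul_of_le_jacobson_bot (Ideal.span {z}) q
        (IsNoetherian.noetherian _)
      · intro a ha
        obtain ⟨b, rfl⟩ := Ideal.mem_span_singleton.1 (hqz ha)
        have hb := (hqp.mem_or_mem ha).resolve_left hzq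
        exact Submodule.smul_mem_smul (Ideal.mem_span_singleton_self z) hb
      · rw [IsLocalRing.jacobson_eq_maximalIdeal _ bot_ne_top]; exact hzm
    subst this
    exact IsDomain.of_bot_isPrime S
  refine ⟨hdom, z, y, hgn, ?_⟩
  intro a b hab
  have hyz : y ∉ Ideal.span {z} := by simpa using hpow _ _ (hgn) 1
  have hz0 : z ≠ 0 := by
    intro h
    have h1 := hgn
    rw [h, Ideal.span_insert_zero] at h1
    apply hht y
    rw [← h1, Ideal.minimalPrimes_eq_subsingleton_self]
    simp
  have h1 : y * b ∈ Ideal.span {z} := by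
    rw [Ideal.mem_span_singleton]
    exact ⟨-a, by linear_combination hab⟩
  obtain ⟨c, rfl⟩ := Ideal.mem_span_singleton.1 ((hzp.mem_or_mem h1).resolve_left hyz)
  refine ⟨-c, ?_, by ring⟩
  apply mul_left_cancel₀ hz0
  linear_combination hab

/-- Key freeness: the kernel of a free cover of a depth one module is free. -/
lemma aux_free (S : Type*) [CommRing S] [IsLocalRing S] [IsNoetherianRing S]
    (x y : S) (hxy : maximalIdeal S = Ideal.span {x, y})
    (hreg : ∀ a b : S, x * a + y * b = 0 → ∃ c, a = y * c ∧ b = -(x * c))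
    (n : ℕ) (K : Submodule S (Fin n → S))
    (hK : ∀ v, x • v ∈ K → y • v ∈ K → v ∈ K) :
    ∃ (r : ℕ) (Φ : (Fin r → S) →ₗ[S] (Fin n → S)), Function.Injective Φ ∧ LinearMap.range Φ = K := by
  classical
  let k := ResidueField S
  let b := Module.finBasis k (k ⊗[S] K)
  have hsurj : Function.Surjective (TensorProduct.mk S k K 1) :=
    TensorProduct.mk_surjective S K k (IsLocalRing.residue_surjective)
  choose v hv using fun i => hsurj (b i)
  have hspan := IsLocalRing.span_eq_top_of_tmul_eq_basis v b (fun i => hv i)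
  let e : (Fin (Module.finrank k (k ⊗[S] K)) → S) →ₗ[S] K := Fintype.linearCombination S v
  have he : Function.Surjective e := by
    rw [← LinearMap.range_eq_top, ← hspan]
    exact Fintype.range_linearCombination S v
  have hmin : ∀ l, e l = 0 → ∀ i, l i ∈ maximalIdeal S := by
    intro l hl i
    have h1 : (∑ i, residue S (l i) • b i) = 0 := by
      have h2 := congrArg (TensorProduct.mk S k K 1) hl
      simp only [e, Fintype.linearCombination_apply, map_sum, map_smul, hv, map_zero] at h2
      rw [← h2]
      refine Finset.sum_congr rfl fun i _ => ?_
      exact (algebraMap_smul k (l i) (b i))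
    have h2 := (Fintype.linearIndependent_iff.1 b.linearIndependent) _ h1 i
    rwa [residue_eq_zero_iff] at h2
  have hinj : LinearMap.ker e = ⊥ := by
    apply Submodule.eq_bot_of_le_smul_of_le_jacobson_bot (maximalIdeal S) _
        (IsNoetherian.noetherian _) _ (by rw [IsLocalRing.jacobson_eq_maximalIdeal _ bot_ne_top])
    intro l hl
    have hl0 : e l = 0 := hl
    have h1 : ∀ i, ∃ a b, x * a + y * b = l i := by
      intro i
      have := hmin l hl0 i
      rw [hxy, Ideal.mem_span_pair] at this
      obtain ⟨a, b, h⟩ := this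
      exact ⟨a, b, by rw [← h]; ring⟩
    choose a b' hab using h1
    have hlab : l = x • a + y • b' := by ext i; simp [hab]
    have h2 : x • (e a : Fin n → S) + y • (e b' : Fin n → S) = 0 := by
      have := congrArg Subtype.val hl0
      rw [hlab] at this
      simpa using this
    have h3 : ∀ i, ∃ c, (e a : Fin n → S) i = y * c ∧ (e b' : Fin n → S) i = -(x * c) := by
      intro i
      exact hreg _ _ (by simpa using congrFun h2 i)
    choose c hc1 hc2 using h3
    have hc : c ∈ K := by
      apply hK
      · have : x • c = -(e b' : Fin n → S) := by ext i; simp [hc2]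
        rw [this]; exact K.neg_mem (e b').2
      · have : y • c = (e a : Fin n → S) := by ext i; simp [hc1]
        rw [this]; exact (e a).2
    obtain ⟨c', hc'⟩ := he ⟨c, hc⟩
    have h4 : l = x • (a - y • c') + y • (b' + x • c') := by
      rw [hlab, smul_sub, smul_add, smul_comm y x]; abel
    have hx : x ∈ maximalIdeal S := by rw [hxy]; exact Ideal.subset_span (by simp)
    have hy : y ∈ maximalIdeal S := by rw [hxy]; exact Ideal.subset_span (by simp)
    rw [h4]
    refine Submodule.add_mem _ (Submodule.smul_mem_smul hx ?_) (Submodule.smul_mem_smul hy ?_)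
    · rw [LinearMap.mem_ker, map_sub, map_smul, hc']
      ext i; simp [hc1]
    · rw [LinearMap.mem_ker, map_add, map_smul, hc']
      ext i; simp [hc2]
  refine ⟨_, K.subtype ∘ₗ e, ?_, ?_⟩
  · exact K.injective_subtype.comp (LinearMap.ker_eq_bot.1 hinj)
  · rw [LinearMap.range_comp, LinearMap.range_eq_top.2 he]; simp

lemma aux_mf (S : Type*) [CommRing S] [IsLocalRing S] [IsNoetherianRing S] [IsDomain S]
    (x y : S) (hxy : maximalIdeal S = Ideal.span {x, y})
    (hreg : ∀ a b : S, x * a + y * b = 0 → ∃ c, a = y * c ∧ b = -(x * c))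
    (f : S) (hf : f ≠ 0)
    (n : ℕ) (K : Submodule S (Fin n → S)) (hfK : ∀ v, f • v ∈ K)
    (hK : ∀ v, x • v ∈ K → y • v ∈ K → v ∈ K) :
    ∃ (Φ Ψ : (Fin n → S) →ₗ[S] (Fin n → S)), LinearMap.range Φ = K ∧
      Function.Injective Φ ∧ Function.Injective Ψ ∧
      (∀ v, Φ (Ψ v) = f • v) ∧ (∀ v, Ψ (Φ v) = f • v) := by
  obtain ⟨r, Φ, hinj, hr⟩ := aux_free S x y hxy hreg n K hK
  have h1 : ∀ v, ∃ w, Φ w = f • v := by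
    intro v
    have := hfK v
    rw [← hr] at this
    exact this
  choose Ψ hΨ using h1
  let Ψ' : (Fin n → S) →ₗ[S] (Fin r → S) :=
    { toFun := Ψ
      map_add' := fun a b => hinj (by simp [hΨ])
      map_smul' := fun a b => hinj (by rw [map_smul, hΨ, RingHom.id_apply, hΨ, smul_comm]) }
  have hΨ' : ∀ v, Φ (Ψ' v) = f • v := hΨ
  have hΨi : Function.Injective Ψ' := by
    intro a b hab
    have := congrArg Φ hab
    rw [hΨ', hΨ'] at this
    exact smul_right_injective _ hf this
  have hn : r = n := le_antisymm (le_of_fin_injective S Φ hinj) (le_of_fin_injective S Ψ' hΨi)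
  subst hn
  exact ⟨Φ, Ψ', hr, hinj, hΨi, hΨ', fun v => hinj (by rw [hΨ', map_smul])⟩

lemma aux_periodic (S : Type*) [CommRing S] [IsLocalRing S] [IsNoetherianRing S] [IsDomain S]
    (x y : S) (hxy : maximalIdeal S = Ideal.span {x, y})
    (hreg : ∀ a b : S, x * a + y * b = 0 → ∃ c, a = y * c ∧ b = -(x * c))
    (f : S) (hf : f ≠ 0) (B : Type*) [AddCommGroup B] [Module (S ⧸ Ideal.span {f}) B]
    [Module.Finite (S ⧸ Ideal.span {f}) B]
    (hB : ∀ b : B, Ideal.Quotient.mk (Ideal.span {f}) x • b = 0 →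
      Ideal.Quotient.mk (Ideal.span {f}) y • b = 0 → b = 0) :
    ∃ (n : ℕ) (φ ψ : (Fin n → S ⧸ Ideal.span {f}) →ₗ[S ⧸ Ideal.span {f}] (Fin n → S ⧸ Ideal.span {f}))
      (π : (Fin n → S ⧸ Ideal.span {f}) →ₗ[S ⧸ Ideal.span {f}] B),
      Function.Surjective π ∧ Function.Exact φ π ∧ Function.Exact φ ψ ∧ Function.Exact ψ φ := by
  obtain ⟨n, π, hπ⟩ := Module.Finite.exists_fin' (S ⧸ Ideal.span {f}) B
  let R := S ⧸ Ideal.span {f}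
  let q : (Fin n → S) →ₗ[S] (Fin n → R) :=
    LinearMap.compLeft (Ideal.span {f}).mkQ (Fin n)
  have hq : ∀ v i, q v i = Ideal.Quotient.mk _ (v i) := fun _ _ => rfl
  have hqs : Function.Surjective q := by
    intro v
    choose w hw using fun i => Ideal.Quotient.mk_surjective (v i)
    exact ⟨w, funext hw⟩
  have hqsm : ∀ (s : S) v, q (s • v) = Ideal.Quotient.mk (Ideal.span {f}) s • q v := by
    intro s v; ext i; simp [hq]
  have hqk : ∀ v, q v = 0 ↔ ∃ w, v = f • w := by
    intro v
    constructor
    · intro h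
      have : ∀ i, ∃ w, v i = f * w := fun i => by
        have h1 : Ideal.Quotient.mk (Ideal.span {f}) (v i) = 0 := congrFun h i
        rw [Ideal.Quotient.eq_zero_iff_mem, Ideal.mem_span_singleton] at h1
        exact h1
      choose w hw using this
      exact ⟨w, funext hw⟩
    · rintro ⟨w, rfl⟩
      have : Ideal.Quotient.mk (Ideal.span {f}) f = 0 := by
        rw [Ideal.Quotient.eq_zero_iff_mem]; exact Ideal.mem_span_singleton_self f
      rw [hqsm, this, zero_smul]
  let K : Submodule S (Fin n → S) := ((LinearMap.ker π).restrictScalars S).comap q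
  have hKm : ∀ v, v ∈ K ↔ π (q v) = 0 := fun v => Iff.rfl
  obtain ⟨Φ, Ψ, hr, hΦ, hΨ, h1, h2⟩ := aux_mf S x y hxy hreg f hf n K
    (by intro v; rw [hKm, (hqk _).2 ⟨v, rfl⟩, map_zero])
    (by
      intro v hx hy
      rw [hKm] at *
      rw [hqsm, map_smul] at hx hy
      exact hB _ hx hy)
  -- descend a linear map
  have desc : ∀ F : (Fin n → S) →ₗ[S] (Fin n → S),
      ∃ g : (Fin n → R) →ₗ[R] (Fin n → R), ∀ v, g (q v) = q (F v) := by
    intro F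
    refine ⟨Matrix.toLin' ((LinearMap.toMatrix' F).map (Ideal.Quotient.mk _)), fun v => ?_⟩
    have h3 : F v = Matrix.toLin' (LinearMap.toMatrix' F) v := by simp
    rw [h3, Matrix.toLin'_apply, Matrix.toLin'_apply]
    ext i
    simp only [hq, Matrix.mulVec, dotProduct, Matrix.map_apply, map_sum, map_mul]
  obtain ⟨φ, hφ⟩ := desc Φ
  obtain ⟨ψ, hψ⟩ := desc Ψ
  refine ⟨n, φ, ψ, π, hπ, ?_, ?_, ?_⟩
  · intro v
    obtain ⟨v, rfl⟩ := hqs v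
    rw [← hKm, ← hr]
    constructor
    · rintro ⟨w, rfl⟩; exact ⟨q w, hφ w⟩
    · rintro ⟨w, hw⟩
      obtain ⟨w, rfl⟩ := hqs w
      rw [hφ, ← sub_eq_zero, ← map_sub, hqk] at hw
      obtain ⟨u, hu⟩ := hw
      refine ⟨w - Ψ u, ?_⟩
      rw [map_sub, h1, ← hu]; abel
  · intro v
    obtain ⟨v, rfl⟩ := hqs v
    rw [hψ, hqk]
    constructor
    · rintro ⟨w, hw⟩
      refine ⟨q w, ?_⟩
      rw [hφ]
      congr 1
      apply hΨ
      rw [h2, hw]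
    · rintro ⟨w, hw⟩
      obtain ⟨w, rfl⟩ := hqs w
      rw [hφ, ← sub_eq_zero, ← map_sub, hqk] at hw
      obtain ⟨u, hu⟩ := hw
      refine ⟨w - Ψ u, ?_⟩
      rw [smul_sub, ← h2 w, ← map_smul Ψ, ← hu, map_sub]; abel
  · intro v
    obtain ⟨v, rfl⟩ := hqs v
    rw [hφ, hqk]
    constructor
    · rintro ⟨w, hw⟩
      refine ⟨q w, ?_⟩
      rw [hψ]
      congr 1
      apply hΦ
      rw [h1, hw]
    · rintro ⟨w, hw⟩
      obtain ⟨w, rfl⟩ := hqs w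
      rw [hψ, ← sub_eq_zero, ← map_sub, hqk] at hw
      obtain ⟨u, hu⟩ := hw
      refine ⟨w - Φ u, ?_⟩
      rw [smul_sub, ← h1 w, ← map_smul Φ, ← hu, map_sub]; abel

noncomputable def perComplex (R : Type) [CommRing R] (F : Type) [AddCommGroup F] [Module R F]
    (φ ψ : F →ₗ[R] F) (h1 : ∀ v, ψ (φ v) = 0) (h2 : ∀ v, φ (ψ v) = 0) :
    ChainComplex (ModuleCat R) ℕ :=
  HomologicalComplex.alternatingConst (ModuleCat.of R F) (φ := ModuleCat.ofHom ψ)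
    (ψ := ModuleCat.ofHom φ) (by ext v; exact h2 v) (by ext v; exact h1 v)
    fun _ _ => ComplexShape.down_nat_odd_add

lemma perComplex_d_even (R : Type) [CommRing R] (F : Type) [AddCommGroup F] [Module R F]
    (φ ψ : F →ₗ[R] F) (h1 : ∀ v, ψ (φ v) = 0) (h2 : ∀ v, φ (ψ v) = 0) (i : ℕ) (hi : Even i) :
    (perComplex R F φ ψ h1 h2).d (i+1) i = ModuleCat.ofHom φ := by
  have : ¬ Even (i+1) := by simpa [Nat.even_add_one] using hi
  simp [perComplex, this]
  rfl

lemma perComplex_d_odd (R : Type) [CommRing R] (F : Type) [AddCommGroup F] [Module R F]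
    (φ ψ : F →ₗ[R] F) (h1 : ∀ v, ψ (φ v) = 0) (h2 : ∀ v, φ (ψ v) = 0) (i : ℕ) (hi : ¬ Even i) :
    (perComplex R F φ ψ h1 h2).d (i+1) i = ModuleCat.ofHom ψ := by
  have : Even (i+1) := by simpa [Nat.even_add_one] using hi
  simp [perComplex, this]
  rfl

lemma exact_iff_fun {R : Type} [CommRing R] (T : ShortComplex (ModuleCat R)) :
    T.Exact ↔ Function.Exact T.f.hom T.g.hom := by
  rw [ShortComplex.moduleCat_exact_iff_range_eq_ker, LinearMap.exact_iff, eq_comm]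

noncomputable def perRes (R : Type) [CommRing R] (F B : Type) [AddCommGroup F] [Module R F]
    [Module.Projective R F] [AddCommGroup B] [Module R B]
    (φ ψ : F →ₗ[R] F) (π : F →ₗ[R] B) (hπ : Function.Surjective π) (h0 : Function.Exact φ π)
    (h1 : Function.Exact φ ψ) (h2 : Function.Exact ψ φ) :
    ProjectiveResolution (ModuleCat.of R B) where
  complex := perComplex R F φ ψ h1.apply_apply_eq_zero h2.apply_apply_eq_zero
  projective _ := inferInstanceAs <| Projective (ModuleCat.of R F)
  π := ((perComplex R F φ ψ h1.apply_apply_eq_zero h2.apply_apply_eq_zero).toSingle₀Equiv _).symm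
    ⟨ModuleCat.ofHom π, by
      rw [perComplex_d_even _ _ _ _ _ _ 0 (by simp)]; ext v; exact h0.apply_apply_eq_zero v⟩
  quasiIso := by
    constructor
    intro m
    cases m with
    | zero =>
      rw [ChainComplex.quasiIsoAt₀_iff, ShortComplex.quasiIso_iff_of_zeros' _ rfl rfl rfl]
      constructor
      · rw [exact_iff_fun]
        have := perComplex_d_even R F φ ψ h1.apply_apply_eq_zero h2.apply_apply_eq_zero 0 (by simp)
        have h5 : ((perComplex R F φ ψ h1.apply_apply_eq_zero h2.apply_apply_eq_zero).d 1 0).hom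
          = φ := congrArg ModuleCat.Hom.hom this
        change Function.Exact ((perComplex R F φ ψ h1.apply_apply_eq_zero
          h2.apply_apply_eq_zero).d 1 0).hom _
        rw [h5]
        simpa [ChainComplex.toSingle₀Equiv] using! h0
      · rw [ModuleCat.epi_iff_surjective]
        simpa [ChainComplex.toSingle₀Equiv] using! hπ
    | succ m =>
      rw [quasiIsoAt_iff_exactAt' (hL := ChainComplex.exactAt_succ_single_obj ..),
          HomologicalComplex.exactAt_iff' _ (m + 2) (m + 1) m (by simp) (by simp), exact_iff_fun]
      by_cases hm : Even m
      · have h3 := perComplex_d_even R F φ ψ h1.apply_apply_eq_zero h2.apply_apply_eq_zero m hm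
        have h4 := perComplex_d_odd R F φ ψ h1.apply_apply_eq_zero h2.apply_apply_eq_zero (m+1)
          (by simpa [Nat.even_add_one] using hm)
        change Function.Exact ((perComplex R F φ ψ h1.apply_apply_eq_zero
          h2.apply_apply_eq_zero).d (m+2) (m+1)).hom ((perComplex R F φ ψ h1.apply_apply_eq_zero
          h2.apply_apply_eq_zero).d (m+1) m).hom
        have h5 : ((perComplex R F φ ψ h1.apply_apply_eq_zero h2.apply_apply_eq_zero).d (m+1) m).hom
          = φ := congrArg ModuleCat.Hom.hom h3
        have h6 : ((perComplex R F φ ψ h1.apply_apply_eq_zero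
          h2.apply_apply_eq_zero).d (m+2) (m+1)).hom = ψ := congrArg ModuleCat.Hom.hom h4
        rw [h5, h6]
        exact h2
      · have h3 := perComplex_d_odd R F φ ψ h1.apply_apply_eq_zero h2.apply_apply_eq_zero m hm
        have h4 := perComplex_d_even R F φ ψ h1.apply_apply_eq_zero h2.apply_apply_eq_zero (m+1)
          (by simpa [Nat.even_add_one] using hm)
        change Function.Exact ((perComplex R F φ ψ h1.apply_apply_eq_zero
          h2.apply_apply_eq_zero).d (m+2) (m+1)).hom ((perComplex R F φ ψ h1.apply_apply_eq_zero
          h2.apply_apply_eq_zero).d (m+1) m).hom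
        have h5 : ((perComplex R F φ ψ h1.apply_apply_eq_zero h2.apply_apply_eq_zero).d (m+1) m).hom
          = ψ := congrArg ModuleCat.Hom.hom h3
        have h6 : ((perComplex R F φ ψ h1.apply_apply_eq_zero
          h2.apply_apply_eq_zero).d (m+2) (m+1)).hom = φ := congrArg ModuleCat.Hom.hom h4
        rw [h5, h6]
        exact h1

lemma tor_two_iff (R : Type) [CommRing R] (F A B : Type) [AddCommGroup F] [Module R F]
    [Module.Projective R F] [AddCommGroup B] [Module R B] [AddCommGroup A] [Module R A]
    (φ ψ : F →ₗ[R] F) (π : F →ₗ[R] B) (hπ : Function.Surjective π) (h0 : Function.Exact φ π)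
    (h1 : Function.Exact φ ψ) (h2 : Function.Exact ψ φ) :
    Subsingleton (TorGroup R 2 A B) ↔ Function.Exact (φ.lTensor A) (ψ.lTensor A) := by
  have e := (perRes R F B φ ψ π hπ h0 h1 h2).isoLeftDerivedObj
    ((MonoidalCategory.tensoringLeft (ModuleCat R)).obj (ModuleCat.of R A)) 2
  rw [TorGroup, ← ModuleCat.isZero_iff_subsingleton]
  refine (e.isZero_iff).trans ?_
  change Limits.IsZero (HomologicalComplex.homology _ 2) ↔ _
  rw [← HomologicalComplex.exactAt_iff_isZero_homology,
    HomologicalComplex.exactAt_iff' _ 3 2 1 (by simp) (by simp), exact_iff_fun]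
  have h3 := perComplex_d_even R F φ ψ h1.apply_apply_eq_zero h2.apply_apply_eq_zero 2 (by decide)
  have h4 := perComplex_d_odd R F φ ψ h1.apply_apply_eq_zero h2.apply_apply_eq_zero 1 (by decide)
  have h5 : ((perComplex R F φ ψ h1.apply_apply_eq_zero h2.apply_apply_eq_zero).d 3 2).hom
    = φ := congrArg ModuleCat.Hom.hom h3
  have h6 : ((perComplex R F φ ψ h1.apply_apply_eq_zero h2.apply_apply_eq_zero).d 2 1).hom
    = ψ := congrArg ModuleCat.Hom.hom h4
  change Function.Exact (((perComplex R F φ ψ h1.apply_apply_eq_zero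
      h2.apply_apply_eq_zero).d 3 2).hom.lTensor A) (((perComplex R F φ ψ h1.apply_apply_eq_zero
      h2.apply_apply_eq_zero).d 2 1).hom.lTensor A) ↔ _
  rw [h5, h6]
  exact Iff.rfl

lemma ext_subsingleton_of_subsingleton (R : Type) [CommRing R] [IsLocalRing R]
    (M : Type) [AddCommGroup M] [Module R M] [Subsingleton M] (n : ℕ) (N : Type) [AddCommGroup N]
    [Module R N] : Subsingleton (ExtGroup R n N M) := by
  have P := projectiveResolution (ModuleCat.of R N)
  rw [ExtGroup, ← ModuleCat.isZero_iff_subsingleton, (P.isoExt n _).isZero_iff,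
    ← HomologicalComplex.exactAt_iff_isZero_homology, HomologicalComplex.exactAt_iff]
  apply ShortComplex.exact_of_isZero_X₂
  rw [ModuleCat.isZero_iff_subsingleton]
  refine ⟨fun (a b : P.complex.X n ⟶ ModuleCat.of R M) => ?_⟩
  exact ModuleCat.hom_ext (LinearMap.ext fun v => Subsingleton.elim (α := M) _ _)

lemma ext_iff (R : Type) [CommRing R] 
    (M N : Type) [AddCommGroup M] [Module R M] [AddCommGroup N] [Module R N]
    (P : ProjectiveResolution (ModuleCat.of R N)) (n : ℕ) : 
    Subsingleton (ExtGroup R (n+1) N M) ↔ ∀ g : P.complex.X (n+1) ⟶ ModuleCat.of R M,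
      P.complex.d (n+2) (n+1) ≫ g = 0 → ∃ h : P.complex.X n ⟶ ModuleCat.of R M, P.complex.d (n+1) n ≫ h = g := by
  rw [ExtGroup, ← ModuleCat.isZero_iff_subsingleton, (P.isoExt (n+1) _).isZero_iff,
    ← HomologicalComplex.exactAt_iff_isZero_homology, 
    HomologicalComplex.exactAt_iff' _ n (n+1) (n+2) (by simp) (by simp), ShortComplex.moduleCat_exact_iff]
  exact Iff.rfl

lemma ext_zero_iff' (R : Type) [CommRing R] 
    (M N : Type) [AddCommGroup M] [Module R M] [AddCommGroup N] [Module R N]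
    (P : ProjectiveResolution (ModuleCat.of R N)) : 
    Subsingleton (ExtGroup R 0 N M) ↔ ∀ g : P.complex.X 0 ⟶ ModuleCat.of R M,
      P.complex.d 1 0 ≫ g = 0 → g = 0 := by
  rw [ExtGroup, ← ModuleCat.isZero_iff_subsingleton, (P.isoExt 0 _).isZero_iff,
    ← HomologicalComplex.exactAt_iff_isZero_homology, 
    HomologicalComplex.exactAt_iff' _ 0 0 1 (by simp) (by simp), ShortComplex.moduleCat_exact_iff]
  constructor
  · intro h g hg
    obtain ⟨k, hk⟩ := h g hg
    have : (P.complex.linearYonedaObj R (ModuleCat.of R M)).d 0 0 = 0 :=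
      HomologicalComplex.shape _ _ _ (by simp)
    change ((P.complex.linearYonedaObj R (ModuleCat.of R M)).d 0 0).hom k = g at hk
    have h5 : ((P.complex.linearYonedaObj R (ModuleCat.of R M)).d 0 0).hom k = 0 := by
      rw [this]; rfl
    exact hk.symm.trans h5
  · intro h g hg
    refine ⟨0, ?_⟩
    rw [map_zero]
    exact (h g hg).symm

lemma ext_zero_iff (R : Type) [CommRing R] [IsLocalRing R]
    (M : Type) [AddCommGroup M] [Module R M] :
    Subsingleton (ExtGroup R 0 (ResidueField R) M) ↔
      ∀ u : M, (∀ r ∈ maximalIdeal R, r • u = 0) → u = 0 := by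
  let P := projectiveResolution (ModuleCat.of R (ResidueField R))
  rw [ext_zero_iff' R M _ P]
  let p : P.complex.X 0 →ₗ[R] ResidueField R := (P.π.f 0).hom
  have hp : Function.Surjective p := (ModuleCat.epi_iff_surjective _).1 (inferInstanceAs (Epi (P.π.f 0)))
  have hex : Function.Exact (P.complex.d 1 0).hom p := (exact_iff_fun _).1 P.exact₀
  constructor
  · intro h u hu
    let q : ResidueField R →ₗ[R] M :=
      Submodule.liftQ (maximalIdeal R) (LinearMap.toSpanSingleton R M u) (by
        intro r hr; simpa using hu r hr)
    have hq : q (residue R 1) = u := by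
      exact (Submodule.liftQ_apply (maximalIdeal R) (LinearMap.toSpanSingleton R M u) 1).trans
        (one_smul R u)
    have h3 := h (ModuleCat.ofHom (q ∘ₗ p)) (by
      ext v
      change q (p ((P.complex.d 1 0).hom v)) = 0
      rw [hex.apply_apply_eq_zero, map_zero])
    obtain ⟨v, hv⟩ := hp (residue R 1)
    have h4 : q (p v) = 0 := congrArg (fun f => f.hom v) h3
    rw [hv, hq] at h4
    exact h4
  · intro h g hg
    ext v
    apply h (g.hom v)
    intro r hr
    rw [← map_smul]
    have h1 : p (r • v) = 0 := by
      rw [map_smul, ← algebraMap_smul (ResidueField R) r (p v)]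
      have : algebraMap R (ResidueField R) r = 0 := (residue_eq_zero_iff r).2 hr
      rw [this, zero_smul]
    obtain ⟨w, hw⟩ := (hex _).1 h1
    rw [← hw]
    exact congrArg (fun f => f.hom w) hg

lemma ext_one_nontrivial (R : Type) [CommRing R] [IsLocalRing R]
    (M : Type) [AddCommGroup M] [Module R M] (x : R) (hx : x ∈ maximalIdeal R)
    (hreg : ∀ a b : M, x • a = x • b → a = b) (u : M) (hu : ∀ w : M, u ≠ x • w)
    (hmu : ∀ r ∈ maximalIdeal R, ∃ w : M, x • w = r • u) :
    Nontrivial (ExtGroup R 1 (ResidueField R) M) := by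
  rw [← not_subsingleton_iff_nontrivial]
  let P := projectiveResolution (ModuleCat.of R (ResidueField R))
  rw [ext_iff R M _ P 0]
  intro H
  let p : P.complex.X 0 →ₗ[R] ResidueField R := (P.π.f 0).hom
  have hp : Function.Surjective p := (ModuleCat.epi_iff_surjective _).1 (inferInstanceAs (Epi (P.π.f 0)))
  have hex : Function.Exact (P.complex.d 1 0).hom p := (exact_iff_fun _).1 P.exact₀
  choose! g hg using hmu
  let g' : maximalIdeal R →ₗ[R] M :=
    { toFun := fun r => g r
      map_add' := fun a b => hreg _ _ (by
        rw [smul_add, hg _ a.2, hg _ b.2, hg _ (a + b).2, Submodule.coe_add, add_smul])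
      map_smul' := fun a b => hreg _ _ (by
        rw [hg _ (a • b).2, RingHom.id_apply, smul_comm, hg _ b.2, Submodule.coe_smul, smul_assoc]) }
  have hproj : Module.Projective R (P.complex.X 0) :=
    (IsProjective.iff_projective (P.complex.X 0)).2 (P.projective 0)
  obtain ⟨h, hh⟩ := Module.projective_lifting_property (maximalIdeal R).mkQ p
    (Submodule.mkQ_surjective _)
  have hh' : ∀ v, residue R (h v) = p v := fun v => LinearMap.congr_fun hh v
  have hm : ∀ v, h ((P.complex.d 1 0).hom v) ∈ maximalIdeal R := by
    intro v
    rw [← residue_eq_zero_iff, hh', hex.apply_apply_eq_zero]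
  let c : P.complex.X 1 →ₗ[R] M := g' ∘ₗ (LinearMap.codRestrict (maximalIdeal R)
    (h ∘ₗ (P.complex.d 1 0).hom) hm)
  have hc : ∀ v, x • c v = h ((P.complex.d 1 0).hom v) • u := fun v => hg _ (hm v)
  obtain ⟨k, hk⟩ := H (ModuleCat.ofHom c) (by
    ext v
    apply hreg
    change x • c ((P.complex.d 2 1).hom v) = x • (0 : M)
    rw [hc]
    have : (P.complex.d 1 0).hom ((P.complex.d 2 1).hom v) = 0 :=
      congrArg (fun f => f.hom v) (P.complex.d_comp_d 2 1 0)
    rw [this, map_zero, zero_smul, smul_zero])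
  have hk' : ∀ v, k.hom ((P.complex.d 1 0).hom v) = c v := fun v => congrArg (fun f => f.hom v) hk
  obtain ⟨v, hv⟩ := hp 1
  have hunit : IsUnit (h v) := by
    have : residue R (h v) ≠ 0 := by rw [hh', hv]; exact one_ne_zero
    rwa [Ne, residue_eq_zero_iff, mem_maximalIdeal, mem_nonunits_iff, not_not] at this
  have h1 : p (x • v) = 0 := by
    rw [map_smul, ← algebraMap_smul (ResidueField R) x (p v)]
    have : algebraMap R (ResidueField R) x = 0 := (residue_eq_zero_iff x).2 hx
    rw [this, zero_smul]
  obtain ⟨w, hw⟩ := (hex _).1 h1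
  have h2 := hk' w
  have h3 := hc w
  rw [← h2, hw, map_smul, map_smul, smul_eq_mul, mul_smul] at h3
  have h4 : x • k.hom v = h v • u := hreg _ _ h3
  obtain ⟨e, he⟩ := hunit
  apply hu (((e⁻¹ : Rˣ) : R) • k.hom v)
  rw [smul_comm]
  erw [h4]
  rw [← he, smul_smul, Units.inv_mul, one_smul]

lemma mcm_iff (R : Type) [CommRing R] [IsLocalRing R]
    (M : Type) [AddCommGroup M] [Module R M] :
    moduleDepth R M = 1 ↔ Subsingleton (ExtGroup R 0 (ResidueField R) M) ∧
      Nontrivial (ExtGroup R 1 (ResidueField R) M) := by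
  unfold moduleDepth
  set T := {i : ℕ∞ | ∃ n : ℕ, i = n ∧ Nontrivial (ExtGroup R n (ResidueField R) M)} with hT
  constructor
  · intro h
    have h0 : (0 : ℕ∞) ∉ T := fun h0 => by
      have := sInf_le h0
      rw [h] at this
      exact absurd this (by decide)
    have hne : T.Nonempty := by
      by_contra hne
      rw [Set.not_nonempty_iff_eq_empty] at hne
      rw [hne, sInf_empty] at h
      exact absurd h (by decide)
    have h1 : (1 : ℕ∞) ∈ T := h ▸ csInf_mem hne
    constructor
    · rw [← not_nontrivial_iff_subsingleton]
      exact fun hn => h0 ⟨0, by simp, hn⟩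
    · obtain ⟨n, hn, hn'⟩ := h1
      have : n = 1 := by exact_mod_cast hn.symm
      subst this
      exact hn'
  · rintro ⟨h0, h1⟩
    apply le_antisymm
    · exact sInf_le ⟨1, by simp, h1⟩
    · apply le_sInf
      rintro _ ⟨n, rfl, hn⟩
      cases n with
      | zero => exact absurd hn (not_nontrivial_iff_subsingleton.2 h0)
      | succ n => exact_mod_cast Nat.succ_le_succ (Nat.zero_le n)

lemma tensor_nontrivial (R : Type) [CommRing R] [IsLocalRing R] (A B : Type) [AddCommGroup A]
    [Module R A] [AddCommGroup B] [Module R B] [Module.Finite R A] [Module.Finite R B]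
    [Nontrivial A] [Nontrivial B] : Nontrivial (A ⊗[R] B) := by
  rw [← not_subsingleton_iff_nontrivial]
  intro hs
  have hA : Nontrivial (ResidueField R ⊗[R] A) := by
    rw [← not_subsingleton_iff_nontrivial, IsLocalRing.subsingleton_tensorProduct,
      not_subsingleton_iff_nontrivial]
    infer_instance
  obtain ⟨a, ha⟩ := exists_ne (0 : ResidueField R ⊗[R] A)
  obtain ⟨l, hl⟩ := Module.Projective.exists_dual_ne_zero (ResidueField R) ha
  have hls : Function.Surjective l := by
    intro c
    refine ⟨(c * (l a)⁻¹) • a, ?_⟩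
    rw [map_smul, smul_eq_mul, mul_assoc, inv_mul_cancel₀ hl, mul_one]
  have hms := TensorProduct.mk_surjective R A (ResidueField R) IsLocalRing.residue_surjective
  let g : A →ₗ[R] ResidueField R :=
    (l.restrictScalars R) ∘ₗ (TensorProduct.mk R (ResidueField R) A 1)
  have hg : Function.Surjective g := hls.comp hms
  have hsub : Subsingleton (ResidueField R ⊗[R] B) :=
    (LinearMap.rTensor_surjective B hg).subsingleton
  rw [IsLocalRing.subsingleton_tensorProduct] at hsub
  exact not_subsingleton B hsub

lemma exists_assoc (R : Type) [CommRing R] [IsNoetherianRing R] (M : Type) [AddCommGroup M]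
    [Module R M] (w : M) (hw : w ≠ 0) : ∃ (p : Ideal R) (u : M), p.IsPrime ∧ 
      (∀ r, r ∈ p ↔ r • u = 0) ∧ (∀ r : R, r • w = 0 → r ∈ p) := by
  obtain ⟨p, hp, h⟩ := exists_le_isAssociatedPrime_of_isNoetherianRing R w hw
  rw [isAssociatedPrime_iff] at hp
  obtain ⟨hp, u, rfl⟩ := hp
  refine ⟨_, u, hp, ?_, ?_⟩
  · intro r; simp [Submodule.mem_colon_singleton]
  · intro r hr; apply h; simpa [Submodule.mem_colon_singleton] using hr

lemma ext_one_of_socle (R : Type) [CommRing R] [IsLocalRing R] [IsNoetherianRing R]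
    (hdim : ringKrullDim R = 1) (M : Type) [AddCommGroup M] [Module R M]
    [Module.Finite R M] [Nontrivial M]
    (hsoc : ∀ u : M, (∀ r ∈ maximalIdeal R, r • u = 0) → u = 0) :
    Nontrivial (ExtGroup R 1 (ResidueField R) M) := by
  have hle : Ring.KrullDimLE 1 R := by rw [Ring.krullDimLE_iff, hdim]; rfl
  rw [Ring.krullDimLE_one_iff] at hle
  have hmin : maximalIdeal R ∉ minimalPrimes R := by
    intro h
    have h2 := IsLocalRing.maximalIdeal_height_eq_ringKrullDim (R := R)
    rw [hdim] at h2
    have h3 : (maximalIdeal R).height = 1 := WithBot.coe_injective h2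
    rw [Ideal.height_eq_zero_iff.2 h] at h3
    exact absurd h3 (by decide)
  obtain ⟨x, hx, hxp⟩ : ∃ x ∈ maximalIdeal R, ∀ p ∈ minimalPrimes R, x ∉ p := by
    by_contra! h
    have h1 : (maximalIdeal R : Set R) ⊆ ⋃ p ∈ minimalPrimes R, (id p : Ideal R) := by
      intro x hx
      obtain ⟨p, hp, hxp⟩ := h x hx
      exact Set.mem_biUnion hp hxp
    obtain ⟨p, hp, hmp⟩ := (Ideal.subset_union_prime_finite (f := id)
      (minimalPrimes.finite_of_isNoetherianRing R) ⊥ ⊥ (fun p hp _ _ => hp.1.1)).1 h1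
    have : maximalIdeal R = p := (maximalIdeal.isMaximal R).eq_of_le hp.1.1.ne_top hmp
    exact hmin (this ▸ hp)
  have hmax : ∀ p : Ideal R, p.IsPrime → x ∈ p → p = maximalIdeal R := by
    intro p hp hxp'
    rcases hle p hp with h | h
    · exact absurd hxp' (hxp p h)
    · exact IsLocalRing.eq_maximalIdeal h
  have hreg : ∀ w : M, x • w = 0 → w = 0 := by
    intro w hw
    by_contra hne
    obtain ⟨p, u, hp, hu, hpw⟩ := exists_assoc R M w hne
    have := hmax p hp (hpw x hw)
    have hu0 := hsoc u (fun r hr => (hu r).1 (this ▸ hr))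
    apply hp.ne_top
    rw [Ideal.eq_top_iff_one, hu, hu0, smul_zero]
  have hne : Nontrivial (M ⧸ (Ideal.span {x} • (⊤ : Submodule R M))) := by
    rw [Submodule.Quotient.nontrivial_iff]
    intro h
    have := Submodule.eq_bot_of_le_smul_of_le_jacobson_bot (Ideal.span {x}) (⊤ : Submodule R M)
      Module.Finite.fg_top h.ge (by
        rw [IsLocalRing.jacobson_eq_maximalIdeal _ bot_ne_top, Ideal.span_singleton_le_iff_mem]
        exact hx)
    exact top_ne_bot this
  have hmem : ∀ v : M, (Submodule.Quotient.mk v : M ⧸ (Ideal.span {x} • (⊤ : Submodule R M))) = 0 ↔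
      ∃ w, x • w = v := by
    intro v
    rw [Submodule.Quotient.mk_eq_zero, Submodule.ideal_span_singleton_smul,
      Submodule.mem_smul_pointwise_iff_exists]
    simp
  obtain ⟨w, hw⟩ := exists_ne (0 : M ⧸ (Ideal.span {x} • (⊤ : Submodule R M)))
  obtain ⟨p, u, hp, hu, hpw⟩ := exists_assoc R _ w hw
  have hkill : ∀ v : M ⧸ (Ideal.span {x} • (⊤ : Submodule R M)), x • v = 0 := by
    intro v
    obtain ⟨v, rfl⟩ := Submodule.Quotient.mk_surjective _ v
    rw [← Submodule.Quotient.mk_smul, hmem]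
    exact ⟨v, rfl⟩
  have hpm := hmax p hp (hpw x (hkill w))
  obtain ⟨u, rfl⟩ := Submodule.Quotient.mk_surjective _ u
  refine ext_one_nontrivial R M x hx ?_ u ?_ ?_
  · intro a b hab
    rw [← sub_eq_zero]
    apply hreg
    rw [smul_sub, hab, sub_self]
  · intro w hw
    apply hp.ne_top
    rw [Ideal.eq_top_iff_one, hu, one_smul, hmem]
    exact ⟨w, hw.symm⟩
  · intro r hr
    rw [← hmem, Submodule.Quotient.mk_smul, ← hu, hpm]
    exact hr

lemma local_exact (R : Type) [CommRing R] [IsReduced R] (p : Ideal R) (hp : p ∈ minimalPrimes R)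
    (F A : Type) [AddCommGroup F] [Module R F] [AddCommGroup A] [Module R A]
    (φ ψ : F →ₗ[R] F) (h : Function.Exact φ ψ) (z : A ⊗[R] F) (hz : ψ.lTensor A z = 0) :
    ∃ r, r ∉ p ∧ ∃ w, φ.lTensor A w = r • z := by
  have hpp : p.IsPrime := hp.1.1
  let A' := LocalizedModule p.primeCompl A
  let ι : A →ₗ[R] A' := LocalizedModule.mkLinearMap p.primeCompl A
  have hK : IsField (Localization.AtPrime p) := by
    have := Ring.KrullDimLE.of_isLocalization p hp (Localization.AtPrime p)
    have : IsReduced (Localization.AtPrime p) :=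
      inferInstanceAs (IsReduced (Localization p.primeCompl))
    exact Ring.KrullDimLE.isField_of_isReduced
  have hflat : Module.Flat (Localization.AtPrime p) A' := by
    let _ := hK.toField
    infer_instance
  have hflat' : Module.Flat R A' := Module.Flat.trans R (Localization.AtPrime p) A'
  have hex := Module.Flat.lTensor_exact A' h
  have hloc : IsLocalizedModule p.primeCompl (LinearMap.rTensor F ι) :=
    IsLocalizedModule.rTensor R p.primeCompl (N := F) ι
  have hcomm : ∀ (g : F →ₗ[R] F) v, g.lTensor A' (ι.rTensor F v) = ι.rTensor F (g.lTensor A v) := by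
    intro g v
    rw [← LinearMap.comp_apply, ← LinearMap.comp_apply, LinearMap.lTensor_comp_rTensor,
      LinearMap.rTensor_comp_lTensor]
  have h1 : ψ.lTensor A' (ι.rTensor F z) = 0 := by rw [hcomm, hz, map_zero]
  obtain ⟨w', hw'⟩ := (hex _).1 h1
  obtain ⟨⟨w, s⟩, hws⟩ := IsLocalizedModule.surj p.primeCompl (ι.rTensor F) w'
  have h2 : ι.rTensor F (φ.lTensor A w) = ι.rTensor F ((s : R) • z) := by
    rw [← hcomm, map_smul, ← hw']
    have : (s : R) • w' = ι.rTensor F w := hws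
    rw [← this, map_smul]
  obtain ⟨c, hc⟩ := (IsLocalizedModule.eq_iff_exists p.primeCompl (ι.rTensor F)).1 h2
  refine ⟨c * s, ?_, (c : R) • w, ?_⟩
  · exact (c * s).2
  · rw [map_smul, mul_smul]; exact hc

lemma exact_iff_socle (R : Type) [CommRing R] [IsLocalRing R] [IsNoetherianRing R] [IsReduced R]
    (hdim : ringKrullDim R = 1) (A B : Type) [AddCommGroup A] [Module R A] [AddCommGroup B]
    [Module R B] (hA : ∀ u : A, (∀ r ∈ maximalIdeal R, r • u = 0) → u = 0) (n : ℕ)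
    (φ ψ : (Fin n → R) →ₗ[R] (Fin n → R)) (π : (Fin n → R) →ₗ[R] B)
    (hπ : Function.Surjective π) (h0 : Function.Exact φ π) (h1 : Function.Exact φ ψ) :
    Function.Exact (φ.lTensor A) (ψ.lTensor A) ↔
      ∀ u : A ⊗[R] B, (∀ r ∈ maximalIdeal R, r • u = 0) → u = 0 := by
  have hex := lTensor_exact A h0 hπ
  have hcomp : ∀ w, ψ.lTensor A (φ.lTensor A w) = 0 := by
    intro w
    rw [← LinearMap.comp_apply, ← LinearMap.lTensor_comp, h1.linearMap_comp_eq_zero]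
    simp
  constructor
  · intro hE u hu
    obtain ⟨z, rfl⟩ := LinearMap.lTensor_surjective A hπ u
    have hz : ψ.lTensor A z = 0 := by
      apply (TensorProduct.piScalarRight R R A (Fin n)).injective
      rw [map_zero]
      funext i
      apply hA
      intro r hr
      have h2 := hu r hr
      rw [← map_smul] at h2
      obtain ⟨w, hw⟩ := (hex _).1 h2
      have h3 : r • ψ.lTensor A z = 0 := by rw [← map_smul, ← hw, hcomp]
      rw [← Pi.smul_apply, ← map_smul, h3, map_zero]
      rfl
    obtain ⟨w, rfl⟩ := (hE z).1 hz
    exact (hex _).2 ⟨w, rfl⟩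
  · intro hsoc z
    refine ⟨fun hz => ?_, fun ⟨w, hw⟩ => hw ▸ hcomp w⟩
    apply (hex z).1
    by_contra hne
    let N : Submodule R (A ⊗[R] B) := (LinearMap.ker (ψ.lTensor A)).map (π.lTensor A)
    have hN : (⟨π.lTensor A z, Submodule.mem_map_of_mem hz⟩ : N) ≠ 0 := by
      intro h
      exact hne (congrArg Subtype.val h)
    obtain ⟨p, ⟨u, hu⟩, hp, hpu, -⟩ := exists_assoc R N _ hN
    have hpu' : ∀ r, r ∈ p ↔ r • u = 0 := by
      intro r
      rw [hpu, Subtype.ext_iff]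
      rfl
    obtain ⟨z', hz', rfl⟩ := hu
    have hle : Ring.KrullDimLE 1 R := by rw [Ring.krullDimLE_iff, hdim]; rfl
    rw [Ring.krullDimLE_one_iff] at hle
    rcases hle p hp with h | h
    · obtain ⟨r, hr, w, hw⟩ := local_exact R p h _ A φ ψ h1 z' hz'
      apply hr
      rw [hpu', ← map_smul, ← hw]
      exact (hex _).2 ⟨w, rfl⟩
    · have hm := IsLocalRing.eq_maximalIdeal h
      have hu0 := hsoc _ (fun r hr => (hpu' r).1 (hm ▸ hr))
      apply hp.ne_top
      rw [Ideal.eq_top_iff_one, hpu', hu0, smul_zero]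

/-- Let `R = S/(f)` be a reduced local hypersurface of dimension `1` (with `S` a
`2`-dimensional regular local ring) and let `A`, `B` be maximal Cohen-Macaulay
`R`-modules.  Then `Tor_2^R(A, B) = 0` if and only if `A ⊗_R B` is maximal
Cohen-Macaulay. -/
theorem tor_two_vanishes_iff_tensor_mcm
    (S : Type) [CommRing S] [IsLocalRing S] (hS : IsRegularLocalTwoDim S)
    (f : S) (hf0 : f ≠ 0) [IsLocalRing (S ⧸ Ideal.span {f})]
    (hred : IsReduced (S ⧸ Ideal.span {f}))
    (hdim : ringKrullDim (S ⧸ Ideal.span {f}) = 1)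
    (A B : Type) [AddCommGroup A] [Module (S ⧸ Ideal.span {f}) A]
    [AddCommGroup B] [Module (S ⧸ Ideal.span {f}) B]
    (hA : IsMCM1 (S ⧸ Ideal.span {f}) A) (hB : IsMCM1 (S ⧸ Ideal.span {f}) B) :
    Subsingleton (TorGroup (S ⧸ Ideal.span {f}) 2 A B) ↔
      IsMCM1 (S ⧸ Ideal.span {f}) (A ⊗[S ⧸ Ideal.span {f}] B) := by

  obtain ⟨hN, hdimS, x₀, y₀, hxy₀⟩ := hS
  obtain ⟨hD, x, y, hxy, hreg⟩ := aux_reg_seq S hdimS x₀ y₀ hxy₀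
  obtain ⟨hfA, hA⟩ := hA
  obtain ⟨hfB, hB⟩ := hB
  rw [mcm_iff, ext_zero_iff] at hA hB
  have hnA : Nontrivial A := by
    rw [← not_subsingleton_iff_nontrivial]
    intro h
    have := ext_subsingleton_of_subsingleton (S ⧸ Ideal.span {f}) A 1 (ResidueField (S ⧸ Ideal.span {f}))
    exact not_subsingleton_iff_nontrivial.2 hA.2 this
  have hnB : Nontrivial B := by
    rw [← not_subsingleton_iff_nontrivial]
    intro h
    have := ext_subsingleton_of_subsingleton (S ⧸ Ideal.span {f}) B 1 (ResidueField (S ⧸ Ideal.span {f}))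
    exact not_subsingleton_iff_nontrivial.2 hB.2 this
  have hm : maximalIdeal (S ⧸ Ideal.span {f}) =
      Ideal.span {Ideal.Quotient.mk (Ideal.span {f}) x, Ideal.Quotient.mk (Ideal.span {f}) y} := by
    rw [← IsLocalRing.map_maximalIdeal_of_surjective (Ideal.Quotient.mk (Ideal.span {f}))
      Ideal.Quotient.mk_surjective, hxy, Ideal.map_span, Set.image_pair]
  have hB' : ∀ b : B, Ideal.Quotient.mk (Ideal.span {f}) x • b = 0 →
      Ideal.Quotient.mk (Ideal.span {f}) y • b = 0 → b = 0 := by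
    intro b h1 h2
    apply hB.1
    intro r hr
    rw [hm, Ideal.mem_span_pair] at hr
    obtain ⟨c, d, rfl⟩ := hr
    rw [add_smul, mul_smul, mul_smul, h1, h2, smul_zero, smul_zero, add_zero]
  obtain ⟨n, φ, ψ, π, hπ, h0, h1, h2⟩ := aux_periodic S x y hxy hreg f hf0 B hB'
  rw [tor_two_iff (S ⧸ Ideal.span {f}) _ A B φ ψ π hπ h0 h1 h2,
    exact_iff_socle (S ⧸ Ideal.span {f}) hdim A B hA.1 n φ ψ π hπ h0 h1]
  have hnT := tensor_nontrivial (S ⧸ Ideal.span {f}) A B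
  constructor
  · intro h
    refine ⟨inferInstance, ?_⟩
    rw [mcm_iff, ext_zero_iff]
    exact ⟨h, ext_one_of_socle _ hdim _ h⟩
  · rintro ⟨-, h⟩
    rw [mcm_iff, ext_zero_iff] at h
    exact h.1
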